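/- L²_h L∞_z bound for u^r: for every λ ∈ [0,1) there exists a constant C > 0, depending only on λ, such that for every t ≥ 0, every admissible g, every n ∈ ℕ, and every multi-index α with |α| = n: ‖θ_λ ⟨r⟩ⁿ ∂^α_h u^r‖_{L²_h L^∞_z} ≤ C ( ‖θ ⟨r⟩ⁿ ∂^α_h g‖_{L²} + ‖θ ⟨r⟩ⁿ ∂^α_h ∂_z g‖_{L²} ). -/

import Mathlib

open MeasureTheory Filter Set

noncomputable section

/-- `⟨t⟩ = 1 + t` -/
def angT (t : ℝ) : ℝ := 1 + t

/-- `θ_λ(z) = exp (λ z² / (8⟨t⟩))`; `θ = θ₁`. -/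
def thw (t lam z : ℝ) : ℝ := Real.exp (lam * z ^ 2 / (8 * angT t))

/-- `⟨r⟩ = √(x² + y² + 1)` -/
def angR (x y : ℝ) : ℝ := Real.sqrt (x ^ 2 + y ^ 2 + 1)

/-- `Mₙ = (n+1)⁴ / n!` -/
def Mfac (n : ℕ) : ℝ := ((n : ℝ) + 1) ^ 4 / (n.factorial : ℝ)

/-- `∂_x` -/
def pdx (f : ℝ → ℝ → ℝ → ℝ) : ℝ → ℝ → ℝ → ℝ := fun x y z => deriv (fun x' => f x' y z) x
/-- `∂_y` -/
def pdy (f : ℝ → ℝ → ℝ → ℝ) : ℝ → ℝ → ℝ → ℝ := fun x y z => deriv (fun y' => f x y' z) y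
/-- `∂_z` -/
def pdz (f : ℝ → ℝ → ℝ → ℝ) : ℝ → ℝ → ℝ → ℝ := fun x y z => deriv (fun z' => f x y z') z

/-- `∂^α_h = ∂_x^{α₁} ∂_y^{α₂}` for the multi-index `α = (a, b)` -/
def pdh (a b : ℕ) (f : ℝ → ℝ → ℝ → ℝ) : ℝ → ℝ → ℝ → ℝ := pdx^[a] (pdy^[b] f)

/-- `r ∂_r = x ∂_x + y ∂_y` -/
def rdr (f : ℝ → ℝ → ℝ → ℝ) : ℝ → ℝ → ℝ → ℝ := fun x y z => x * pdx f x y z + y * pdy f x y z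

/-- weighted `L²` norm over `ℝ² × (0,∞)` of `θ_λ ⟨r⟩ⁿ f` -/
def L2w (t lam : ℝ) (n : ℕ) (f : ℝ → ℝ → ℝ → ℝ) : ℝ :=
  Real.sqrt (∫ x : ℝ, ∫ y : ℝ, ∫ z in Ioi (0 : ℝ), (thw t lam z * angR x y ^ n * f x y z) ^ 2)

/-- weighted `L²_z` norm at fixed `(x, y)` of `θ_λ ⟨r⟩ⁿ f (x, y, ·)` -/
def L2z (t lam : ℝ) (n : ℕ) (f : ℝ → ℝ → ℝ → ℝ) (x y : ℝ) : ℝ :=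
  Real.sqrt (∫ z in Ioi (0 : ℝ), (thw t lam z * angR x y ^ n * f x y z) ^ 2)

/-- mixed `L^∞_h L²_z` norm of `θ_λ ⟨r⟩ⁿ f` -/
def LIh2z (t lam : ℝ) (n : ℕ) (f : ℝ → ℝ → ℝ → ℝ) : ℝ :=
  Real.sqrt (∫ z in Ioi (0 : ℝ), (⨆ p : ℝ × ℝ, |thw t lam z * angR p.1 p.2 ^ n * f p.1 p.2 z|) ^ 2)

/-- mixed `L²_h L^∞_z` norm of `θ_λ ⟨r⟩ⁿ f` -/
def L2hIz (t lam : ℝ) (n : ℕ) (f : ℝ → ℝ → ℝ → ℝ) : ℝ :=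
  Real.sqrt (∫ x : ℝ, ∫ y : ℝ,
    (⨆ z : Ioi (0 : ℝ), |thw t lam (z : ℝ) * angR x y ^ n * f x y (z : ℝ)|) ^ 2)

/-- the primitive `φ(x,y,z) = exp(−z²/(4⟨t⟩)) ∫₀^z g(x,y,s) exp(s²/(4⟨t⟩)) ds` -/
def phiF (t : ℝ) (g : ℝ → ℝ → ℝ → ℝ) : ℝ → ℝ → ℝ → ℝ := fun x y z =>
  Real.exp (-(z ^ 2) / (4 * angT t)) * ∫ s in (0 : ℝ)..z, g x y s * Real.exp (s ^ 2 / (4 * angT t))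

/-- `u^r = ∂_z φ` -/
def ur (t : ℝ) (g : ℝ → ℝ → ℝ → ℝ) : ℝ → ℝ → ℝ → ℝ := pdz (phiF t g)

/-- `u^z = −(x∂_x + y∂_y)φ − 2φ` -/
def uzv (t : ℝ) (g : ℝ → ℝ → ℝ → ℝ) : ℝ → ℝ → ℝ → ℝ := fun x y z =>
  -(rdr (phiF t g) x y z) - 2 * phiF t g x y z

/-- smoothness together with rapid decay in `z` of all derivatives -/
def DecaySmooth (g : ℝ → ℝ → ℝ → ℝ) : Prop :=
  ContDiff ℝ (⊤ : ℕ∞) (fun p : ℝ × ℝ × ℝ => g p.1 p.2.1 p.2.2) ∧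
  ∀ a b k m : ℕ, ∀ x y : ℝ,
    Tendsto (fun z : ℝ => z ^ m * pdz^[k] (pdh a b g) x y z) atTop (nhds 0)

/-- `θ ⟨r⟩^{|α|} ∂^α_h g ∈ L²(ℝ² × (0,∞))` for every `α` -/
def L2cond (t : ℝ) (g : ℝ → ℝ → ℝ → ℝ) : Prop :=
  ∀ a b : ℕ,
    Integrable
      (fun p : ℝ × ℝ × ℝ =>
        (thw t 1 p.2.2 * angR p.1 p.2.1 ^ (a + b) * pdh a b g p.1 p.2.1 p.2.2) ^ 2)
      (volume.restrict {p : ℝ × ℝ × ℝ | 0 < p.2.2})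

/-- `θ ⟨r⟩^{|α|} ∂^α_h ∂_z g ∈ L²(ℝ² × (0,∞))` for every `α` -/
def L2condZ (t : ℝ) (g : ℝ → ℝ → ℝ → ℝ) : Prop :=
  ∀ a b : ℕ,
    Integrable
      (fun p : ℝ × ℝ × ℝ =>
        (thw t 1 p.2.2 * angR p.1 p.2.1 ^ (a + b) * pdh a b (pdz g) p.1 p.2.1 p.2.2) ^ 2)
      (volume.restrict {p : ℝ × ℝ × ℝ | 0 < p.2.2})

/-- `X_n(g, τ)` -/
def Xel (t τ : ℝ) (g : ℝ → ℝ → ℝ → ℝ) (n : ℕ) : ℝ :=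
  (∑ a ∈ Finset.range (n + 1), L2w t 1 n (pdh a (n - a) g)) * τ ^ n * Mfac n

/-- `D_n(g, τ) = X_n(∂_z g, τ)` -/
def Del (t τ : ℝ) (g : ℝ → ℝ → ℝ → ℝ) (n : ℕ) : ℝ :=
  (∑ a ∈ Finset.range (n + 1), L2w t 1 n (pdh a (n - a) (pdz g))) * τ ^ n * Mfac n

/-- `Y_n(g, τ)` (with `Y₀ = 0`) -/
def Yel (t τ : ℝ) (g : ℝ → ℝ → ℝ → ℝ) (n : ℕ) : ℝ :=
  (∑ a ∈ Finset.range (n + 1), L2w t 1 n (pdh a (n - a) g)) * τ ^ (n - 1) * (n : ℝ) * Mfac n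

/-- `‖g‖_{X_τ}` -/
def Xnrm (t τ : ℝ) (g : ℝ → ℝ → ℝ → ℝ) : ℝ := ∑' n : ℕ, Xel t τ g n
/-- `‖g‖_{D_τ}` -/
def Dnrm (t τ : ℝ) (g : ℝ → ℝ → ℝ → ℝ) : ℝ := ∑' n : ℕ, Del t τ g n
/-- `‖g‖_{Y_τ}` -/
def Ynrm (t τ : ℝ) (g : ℝ → ℝ → ℝ → ℝ) : ℝ := ∑' n : ℕ, Yel t τ g n

/-- triple integral over `ℝ² × (0,∞)` -/
def trip (F : ℝ → ℝ → ℝ → ℝ) : ℝ := ∫ x : ℝ, ∫ y : ℝ, ∫ z in Ioi (0 : ℝ), F x y z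

/-- `I^α_1` -/
def I1 (t : ℝ) (g : ℝ → ℝ → ℝ → ℝ) (a b : ℕ) : ℝ :=
  -trip fun x y z =>
    thw t 2 z * angR x y ^ (2 * (a + b)) *
      pdh a b (fun x' y' z' => ur t g x' y' z' * rdr g x' y' z') x y z * pdh a b g x y z

/-- `I^α_2` -/
def I2 (t : ℝ) (g : ℝ → ℝ → ℝ → ℝ) (a b : ℕ) : ℝ :=
  -trip fun x y z =>
    thw t 2 z * angR x y ^ (2 * (a + b)) *
      pdh a b (fun x' y' z' => uzv t g x' y' z' * pdz g x' y' z') x y z * pdh a b g x y z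

/-- `I^α_3` -/
def I3 (t : ℝ) (g : ℝ → ℝ → ℝ → ℝ) (a b : ℕ) : ℝ :=
  -trip fun x y z =>
    thw t 2 z * angR x y ^ (2 * (a + b)) *
      pdh a b (fun x' y' z' => ur t g x' y' z' ^ 2) x y z * pdh a b g x y z

/-- `I^α_4` -/
def I4 (t : ℝ) (g : ℝ → ℝ → ℝ → ℝ) (a b : ℕ) : ℝ :=
  (1 / (2 * angT t)) * trip fun x y z =>
    thw t 2 z * angR x y ^ (2 * (a + b)) *
      pdh a b
        (fun x' y' z' =>
          uzv t g x' y' z' * pdz (fun x'' y'' w => w * phiF t g x'' y'' w) x' y' z') x y z *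
      pdh a b g x y z

/-- `I^α_5` -/
def I5 (t : ℝ) (g : ℝ → ℝ → ℝ → ℝ) (a b : ℕ) : ℝ :=
  -(1 / angT t) * trip fun x y z =>
    z * thw t 2 z * angR x y ^ (2 * (a + b)) *
      pdh a b (fun x' y' z' => ur t g x' y' z' * phiF t g x' y' z') x y z * pdh a b g x y z

/-- `I^α_6` -/
def I6 (t : ℝ) (g : ℝ → ℝ → ℝ → ℝ) (a b : ℕ) : ℝ :=
  -(1 / (2 * angT t)) * trip fun x y z =>
    z * thw t 2 z * angR x y ^ (2 * (a + b)) *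
      (∫ s in Ioi z, pdh a b (fun x' y' z' => ur t g x' y' z' ^ 2) x y s) * pdh a b g x y z

/-- `I^α_7` -/
def I7 (t : ℝ) (g : ℝ → ℝ → ℝ → ℝ) (a b : ℕ) : ℝ :=
  (1 / angT t) * trip fun x y z =>
    z * thw t 2 z * angR x y ^ (2 * (a + b)) *
      (∫ s in Ioi z, pdh a b (fun x' y' z' => pdz (ur t g) x' y' z' * uzv t g x' y' z') x y s) *
      pdh a b g x y z

/-- `∑_{|α| = n} |I^α| τⁿ Mₙ / ‖θ ⟨r⟩ⁿ ∂^α_h g‖_{L²}` (with the convention `x / 0 = 0`) -/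
def Qterm (t τ : ℝ) (g : ℝ → ℝ → ℝ → ℝ) (I : ℕ → ℕ → ℝ) (n : ℕ) : ℝ :=
  ∑ a ∈ Finset.range (n + 1), |I a (n - a)| * τ ^ n * Mfac n / L2w t 1 n (pdh a (n - a) g)

/-- `∂_t` -/
def pdt (G : ℝ → ℝ → ℝ → ℝ → ℝ) (t x y z : ℝ) : ℝ := deriv (fun t' => G t' x y z) t

/-- the good-unknown axially symmetric Prandtl equation at the point `(t, x, y, z)` -/
def GoodEq (G : ℝ → ℝ → ℝ → ℝ → ℝ) (t x y z : ℝ) : Prop :=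
  pdt G t x y z
      + ur t (G t) x y z * rdr (G t) x y z
      + uzv t (G t) x y z * pdz (G t) x y z
      - pdz (pdz (G t)) x y z
      + G t x y z / angT t
      + ur t (G t) x y z ^ 2
      - 1 / (2 * angT t) * (uzv t (G t) x y z * pdz (fun x' y' w => w * phiF t (G t) x' y' w) x y z)
      + z / angT t * (ur t (G t) x y z * phiF t (G t) x y z)
      + z / (2 * angT t) * (∫ s in Ioi z, ur t (G t) x y s ^ 2)
      - z / angT t * (∫ s in Ioi z, pdz (ur t (G t)) x y s * uzv t (G t) x y s) = 0

lemma hasDerivAt_intervalIntegral_of_continuous {F F' : ℝ → ℝ → ℝ}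
    (hF : Continuous (Function.uncurry F)) (hF' : Continuous (Function.uncurry F'))
    (hd : ∀ x s, HasDerivAt (fun x' => F x' s) (F' x s) x) (a b x : ℝ) :
    HasDerivAt (fun x' => ∫ s in a..b, F x' s) (∫ s in a..b, F' x s) x := by
  have hc : ∀ x, Continuous (F x) := fun x => hF.comp (Continuous.prodMk_right x)
  have hc' : ∀ x, Continuous (F' x) := fun x => hF'.comp (Continuous.prodMk_right x)
  obtain ⟨M, hM⟩ := ((isCompact_closedBall x 1).prod isCompact_uIcc
    (t := uIcc a b)).exists_bound_of_continuousOn hF'.continuousOn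
  refine (intervalIntegral.hasDerivAt_integral_of_dominated_loc_of_deriv_le
    (bound := fun _ => M) (Metric.closedBall_mem_nhds x one_pos)
    (.of_forall fun x => (hc x).aestronglyMeasurable) ((hc x).intervalIntegrable a b)
    (hc' x).aestronglyMeasurable (.of_forall fun s hs x' hx' => ?_)
    intervalIntegrable_const (.of_forall fun s _ x' _ => hd x' s)).2
  exact hM (x', s) ⟨hx', uIoc_subset_uIcc hs⟩

/-- joint smoothness of a function of three real variables -/
def Smooth3 (f : ℝ → ℝ → ℝ → ℝ) : Prop :=
  ContDiff ℝ (⊤ : ℕ∞) (fun p : ℝ × ℝ × ℝ => f p.1 p.2.1 p.2.2)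

namespace Smooth3

variable {f : ℝ → ℝ → ℝ → ℝ}

lemma hasFDerivAt (hf : Smooth3 f) (p : ℝ × ℝ × ℝ) :
    HasFDerivAt (fun p : ℝ × ℝ × ℝ => f p.1 p.2.1 p.2.2)
      (fderiv ℝ (fun p : ℝ × ℝ × ℝ => f p.1 p.2.1 p.2.2) p) p :=
  (hf.differentiable (by simp) p).hasFDerivAt

lemma hasDerivAt_x' (hf : Smooth3 f) (x y z : ℝ) :
    HasDerivAt (fun x' => f x' y z)
      (fderiv ℝ (fun p : ℝ × ℝ × ℝ => f p.1 p.2.1 p.2.2) (x, y, z) (1, 0, 0)) x :=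
  HasFDerivAt.comp_hasDerivAt (f := fun x' => (x', y, z)) x (hf.hasFDerivAt (x, y, z))
    ((hasDerivAt_id x).prodMk ((hasDerivAt_const x y).prodMk (hasDerivAt_const x z)))

lemma hasDerivAt_y' (hf : Smooth3 f) (x y z : ℝ) :
    HasDerivAt (fun y' => f x y' z)
      (fderiv ℝ (fun p : ℝ × ℝ × ℝ => f p.1 p.2.1 p.2.2) (x, y, z) (0, 1, 0)) y :=
  HasFDerivAt.comp_hasDerivAt (f := fun y' => (x, y', z)) y (hf.hasFDerivAt (x, y, z))
    ((hasDerivAt_const y x).prodMk ((hasDerivAt_id y).prodMk (hasDerivAt_const y z)))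

lemma hasDerivAt_z' (hf : Smooth3 f) (x y z : ℝ) :
    HasDerivAt (fun z' => f x y z')
      (fderiv ℝ (fun p : ℝ × ℝ × ℝ => f p.1 p.2.1 p.2.2) (x, y, z) (0, 0, 1)) z :=
  HasFDerivAt.comp_hasDerivAt (f := fun z' => (x, y, z')) z (hf.hasFDerivAt (x, y, z))
    ((hasDerivAt_const z x).prodMk ((hasDerivAt_const z y).prodMk (hasDerivAt_id z)))

lemma pdx_eq (hf : Smooth3 f) (x y z : ℝ) :
    pdx f x y z = fderiv ℝ (fun p : ℝ × ℝ × ℝ => f p.1 p.2.1 p.2.2) (x, y, z) (1, 0, 0) :=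
  (hf.hasDerivAt_x' x y z).deriv

lemma pdy_eq (hf : Smooth3 f) (x y z : ℝ) :
    pdy f x y z = fderiv ℝ (fun p : ℝ × ℝ × ℝ => f p.1 p.2.1 p.2.2) (x, y, z) (0, 1, 0) :=
  (hf.hasDerivAt_y' x y z).deriv

lemma pdz_eq (hf : Smooth3 f) (x y z : ℝ) :
    pdz f x y z = fderiv ℝ (fun p : ℝ × ℝ × ℝ => f p.1 p.2.1 p.2.2) (x, y, z) (0, 0, 1) :=
  (hf.hasDerivAt_z' x y z).deriv

lemma hasDerivAt_x (hf : Smooth3 f) (x y z : ℝ) :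
    HasDerivAt (fun x' => f x' y z) (pdx f x y z) x :=
  hf.pdx_eq x y z ▸ hf.hasDerivAt_x' x y z

lemma hasDerivAt_y (hf : Smooth3 f) (x y z : ℝ) :
    HasDerivAt (fun y' => f x y' z) (pdy f x y z) y :=
  hf.pdy_eq x y z ▸ hf.hasDerivAt_y' x y z

lemma hasDerivAt_z (hf : Smooth3 f) (x y z : ℝ) :
    HasDerivAt (fun z' => f x y z') (pdz f x y z) z :=
  hf.pdz_eq x y z ▸ hf.hasDerivAt_z' x y z

lemma contDiff_fderiv_apply (hf : Smooth3 f) (v : ℝ × ℝ × ℝ) :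
    ContDiff ℝ (⊤ : ℕ∞)
      (fun p => fderiv ℝ (fun p : ℝ × ℝ × ℝ => f p.1 p.2.1 p.2.2) p v) :=
  (hf.fderiv_right (m := (⊤ : ℕ∞)) (by simp)).clm_apply contDiff_const

lemma smooth_pdx (hf : Smooth3 f) : Smooth3 (pdx f) := by
  simpa only [Smooth3, hf.pdx_eq] using hf.contDiff_fderiv_apply (1, 0, 0)

lemma smooth_pdy (hf : Smooth3 f) : Smooth3 (pdy f) := by
  simpa only [Smooth3, hf.pdy_eq] using hf.contDiff_fderiv_apply (0, 1, 0)

lemma smooth_pdz (hf : Smooth3 f) : Smooth3 (pdz f) := by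
  simpa only [Smooth3, hf.pdz_eq] using hf.contDiff_fderiv_apply (0, 0, 1)

lemma fderiv_fderiv_apply (hf : Smooth3 f) (p v w : ℝ × ℝ × ℝ) :
    fderiv ℝ (fun q => fderiv ℝ (fun p : ℝ × ℝ × ℝ => f p.1 p.2.1 p.2.2) q v) p w =
      fderiv ℝ (fun q => fderiv ℝ (fun p : ℝ × ℝ × ℝ => f p.1 p.2.1 p.2.2) q w) p v := by
  have hd : DifferentiableAt ℝ (fderiv ℝ (fun p : ℝ × ℝ × ℝ => f p.1 p.2.1 p.2.2)) p :=
    (hf.fderiv_right (m := (⊤ : ℕ∞)) (by simp)).differentiable (by simp) p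
  have key : ∀ v w, fderiv ℝ (fun q => fderiv ℝ (fun p : ℝ × ℝ × ℝ => f p.1 p.2.1 p.2.2) q v) p w
      = fderiv ℝ (fderiv ℝ (fun p : ℝ × ℝ × ℝ => f p.1 p.2.1 p.2.2)) p w v := fun v w => by
    rw [fderiv_clm_apply hd (differentiableAt_const v)]
    simp
  rw [key, key]
  exact (hf.contDiffAt.isSymmSndFDerivAt (by
    rw [minSmoothness_of_isRCLikeNormedField]
    exact WithTop.coe_le_coe.2 (le_top : (2 : ℕ∞) ≤ ⊤))) w v

lemma pdx_pdz (hf : Smooth3 f) : pdx (pdz f) = pdz (pdx f) := by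
  funext x y z
  rw [hf.smooth_pdz.pdx_eq, hf.smooth_pdx.pdz_eq]
  simp only [hf.pdz_eq, hf.pdx_eq]
  exact hf.fderiv_fderiv_apply _ _ _

lemma pdy_pdz (hf : Smooth3 f) : pdy (pdz f) = pdz (pdy f) := by
  funext x y z
  rw [hf.smooth_pdz.pdy_eq, hf.smooth_pdy.pdz_eq]
  simp only [hf.pdz_eq, hf.pdy_eq]
  exact hf.fderiv_fderiv_apply _ _ _

end Smooth3

/-- an operator commuting with `∂_x` and `∂_y` on smooth functions commutes with `∂^α_h` -/
lemma pdh_comm {A : (ℝ → ℝ → ℝ → ℝ) → ℝ → ℝ → ℝ → ℝ}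
    (hx : ∀ f, Smooth3 f → pdx (A f) = A (pdx f)) (hy : ∀ f, Smooth3 f → pdy (A f) = A (pdy f))
    (a b : ℕ) {f : ℝ → ℝ → ℝ → ℝ} (hf : Smooth3 f) :
    Smooth3 (pdh a b f) ∧ pdh a b (A f) = A (pdh a b f) := by
  have hb : Smooth3 (pdy^[b] f) ∧ pdy^[b] (A f) = A (pdy^[b] f) := by
    induction b with
    | zero => exact ⟨hf, rfl⟩
    | succ b ih =>
      simp only [Function.iterate_succ_apply']
      exact ⟨ih.1.smooth_pdy, by rw [ih.2, hy _ ih.1]⟩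
  unfold pdh
  induction a with
  | zero => exact hb
  | succ a ih =>
    simp only [Function.iterate_succ_apply']
    exact ⟨ih.1.smooth_pdx, by rw [ih.2, hx _ ih.1]⟩

/-- `f ↦ f − (z / (2⟨t⟩)) φ_f`, which expresses `u^r` through `g` -/
def urOp (t : ℝ) (f : ℝ → ℝ → ℝ → ℝ) : ℝ → ℝ → ℝ → ℝ := fun x y z =>
  f x y z - z / (2 * angT t) * phiF t f x y z

lemma hasDerivAt_gaussian (c z : ℝ) :
    HasDerivAt (fun z : ℝ => Real.exp (c * z ^ 2)) (2 * c * z * Real.exp (c * z ^ 2)) z := by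
  convert ((hasDerivAt_pow 2 z).const_mul c).exp using 1
  ring

lemma Smooth3.ur_eq {t : ℝ} {f : ℝ → ℝ → ℝ → ℝ} (hf : Smooth3 f) : ur t f = urOp t f := by
  funext x y z
  have hc : Continuous fun s => f x y s * Real.exp (s ^ 2 / (4 * angT t)) :=
    (hf.continuous.comp (by fun_prop : Continuous fun s : ℝ => (x, y, s))).mul (by fun_prop)
  have h1 := hasDerivAt_gaussian (-(1 / (4 * angT t))) z
  have h2 := intervalIntegral.integral_hasDerivAt_right (hc.intervalIntegrable 0 z)
    hc.aestronglyMeasurable.stronglyMeasurableAtFilter hc.continuousAt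
  have e : ∀ z : ℝ, -(1 / (4 * angT t)) * z ^ 2 = -(z ^ 2) / (4 * angT t) := fun z => by ring
  simp only [e] at h1
  have h3 : Real.exp (-(z ^ 2) / (4 * angT t)) * Real.exp (z ^ 2 / (4 * angT t)) = 1 := by
    rw [← Real.exp_add, neg_div, neg_add_cancel, Real.exp_zero]
  refine (h1.mul h2).deriv.trans ?_
  simp only [urOp, phiF]
  linear_combination (f x y z) * h3

lemma pdx_urOp {t : ℝ} {f : ℝ → ℝ → ℝ → ℝ} (hf : Smooth3 f) :
    pdx (urOp t f) = urOp t (pdx f) := by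
  funext x y z
  have hm : Continuous fun p : ℝ × ℝ => ((p.1, y, p.2) : ℝ × ℝ × ℝ) := by fun_prop
  refine HasDerivAt.deriv ((hf.hasDerivAt_x x y z).sub (HasDerivAt.const_mul _
    (HasDerivAt.const_mul _ (hasDerivAt_intervalIntegral_of_continuous
      (F := fun x s => f x y s * Real.exp (s ^ 2 / (4 * angT t)))
      (F' := fun x s => pdx f x y s * Real.exp (s ^ 2 / (4 * angT t)))
      ((hf.continuous.comp hm).mul (by fun_prop)) ((hf.smooth_pdx.continuous.comp hm).mul (by fun_prop))
      (fun x s => (hf.hasDerivAt_x x y s).mul_const _) 0 z x))))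

lemma pdy_urOp {t : ℝ} {f : ℝ → ℝ → ℝ → ℝ} (hf : Smooth3 f) :
    pdy (urOp t f) = urOp t (pdy f) := by
  funext x y z
  have hm : Continuous fun p : ℝ × ℝ => ((x, p.1, p.2) : ℝ × ℝ × ℝ) := by fun_prop
  refine HasDerivAt.deriv ((hf.hasDerivAt_y x y z).sub (HasDerivAt.const_mul _
    (HasDerivAt.const_mul _ (hasDerivAt_intervalIntegral_of_continuous
      (F := fun y s => f x y s * Real.exp (s ^ 2 / (4 * angT t)))
      (F' := fun y s => pdy f x y s * Real.exp (s ^ 2 / (4 * angT t)))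
      ((hf.continuous.comp hm).mul (by fun_prop)) ((hf.smooth_pdy.continuous.comp hm).mul (by fun_prop))
      (fun y s => (hf.hasDerivAt_y x y s).mul_const _) 0 z y))))

lemma angT_ge_one {t : ℝ} (ht : 0 ≤ t) : 1 ≤ angT t := by
  unfold angT; linarith

lemma thw_sq (t lam z : ℝ) : thw t lam z ^ 2 = Real.exp (lam * z ^ 2 / (4 * angT t)) := by
  rw [thw, ← Real.exp_nat_mul]
  congr 1
  push_cast
  ring

lemma thw_sq_eq_mul (t lam z : ℝ) :
    thw t lam z ^ 2 = thw t 1 z ^ 2 * Real.exp (-((1 - lam) * z ^ 2 / (4 * angT t))) := by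
  rw [thw_sq, thw_sq, ← Real.exp_add]
  congr 1
  ring

lemma hasDerivAt_thw (t lam z : ℝ) :
    HasDerivAt (thw t lam) (lam * z / (4 * angT t) * thw t lam z) z := by
  have h := hasDerivAt_gaussian (lam / (8 * angT t)) z
  have e : ∀ z : ℝ, lam / (8 * angT t) * z ^ 2 = lam * z ^ 2 / (8 * angT t) := fun z => by ring
  simp only [e] at h
  refine HasDerivAt.congr_deriv (f := thw t lam) h ?_
  unfold thw
  ring

lemma continuous_thw (t lam : ℝ) : Continuous (thw t lam) := by
  unfold thw; fun_prop

lemma div_mul_exp_neg_le {μ T : ℝ} (hμ : 0 < μ) (hT : 1 ≤ T) (z : ℝ) :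
    z / T * Real.exp (-(μ * z ^ 2 / (4 * T))) ≤ 1 + 4 / μ := by
  have hT0 : 0 < T := by linarith
  have hv : 0 ≤ μ * z ^ 2 / (4 * T) := by positivity
  rw [Real.exp_neg, ← div_eq_mul_inv, div_le_iff₀ (Real.exp_pos _)]
  have hE := Real.add_one_le_exp (μ * z ^ 2 / (4 * T))
  have hzT : z / T ≤ 1 + z ^ 2 / T := by
    rw [div_le_iff₀ hT0, add_mul, div_mul_cancel₀ _ hT0.ne']
    nlinarith [sq_nonneg (z - 1)]
  have e : 4 / μ * (μ * z ^ 2 / (4 * T)) = z ^ 2 / T := by field_simp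
  have h4 : 0 ≤ 4 / μ := by positivity
  nlinarith [mul_le_mul_of_nonneg_left hE h4]

lemma cube_div_mul_exp_neg_le {μ T : ℝ} (hμ : 0 < μ) (hT : 1 ≤ T) (z : ℝ) :
    z ^ 3 / T ^ 2 * Real.exp (-(μ * z ^ 2 / (4 * T))) ≤ 4 / μ + 32 / μ ^ 2 := by
  have hT0 : 0 < T := by linarith
  set v := μ * z ^ 2 / (4 * T) with hvdef
  have hv : 0 ≤ v := by positivity
  rw [Real.exp_neg, ← div_eq_mul_inv, div_le_iff₀ (Real.exp_pos _)]
  have hE := Real.quadratic_le_exp_of_nonneg hv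
  have hzT : z / T ≤ 1 + z ^ 2 / T := by
    rw [div_le_iff₀ hT0, add_mul, div_mul_cancel₀ _ hT0.ne']
    nlinarith [sq_nonneg (z - 1)]
  have h1 : z ^ 3 / T ^ 2 ≤ z ^ 2 / T + (z ^ 2 / T) ^ 2 := by
    have := mul_le_mul_of_nonneg_left hzT (by positivity : 0 ≤ z ^ 2 / T)
    calc z ^ 3 / T ^ 2 = z ^ 2 / T * (z / T) := by field_simp
      _ ≤ _ := this
      _ = _ := by ring
  have e : z ^ 2 / T = 4 / μ * v := by rw [hvdef]; field_simp
  have e2 : (z ^ 2 / T) ^ 2 = 32 / μ ^ 2 * (v ^ 2 / 2) := by rw [hvdef]; field_simp; ring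
  rw [e2, e] at h1
  have h4 : 0 ≤ 4 / μ := by positivity
  have h32 : 0 ≤ 32 / μ ^ 2 := by positivity
  nlinarith [mul_le_mul_of_nonneg_left hE h4, mul_le_mul_of_nonneg_left hE h32,
    mul_nonneg h4 (sq_nonneg v), mul_nonneg h32 hv]

lemma sq_intervalIntegral_le {h : ℝ → ℝ} (hh : Continuous h) {z : ℝ} (hz : 0 < z) :
    (∫ s in (0 : ℝ)..z, h s) ^ 2 ≤ z * ∫ s in (0 : ℝ)..z, h s ^ 2 := by
  set I := ∫ s in (0 : ℝ)..z, h s with hI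
  have h0 : 0 ≤ ∫ s in (0 : ℝ)..z, (h s - I / z) ^ 2 :=
    intervalIntegral.integral_nonneg hz.le fun s _ => sq_nonneg _
  have e : ∀ s, (h s - I / z) ^ 2 = h s ^ 2 - (2 * (I / z)) * h s + (I / z) ^ 2 := fun s => by ring
  simp only [e] at h0
  rw [intervalIntegral.integral_add ((by fun_prop : Continuous _).intervalIntegrable _ _)
      ((by fun_prop : Continuous _).intervalIntegrable _ _),
    intervalIntegral.integral_sub ((by fun_prop : Continuous _).intervalIntegrable _ _)
      ((by fun_prop : Continuous _).intervalIntegrable _ _),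
    intervalIntegral.integral_const_mul, intervalIntegral.integral_const, ← hI] at h0
  have e2 : (∫ s in (0 : ℝ)..z, h s ^ 2) - 2 * (I / z) * I + (z - 0) • (I / z) ^ 2
      = (z * (∫ s in (0 : ℝ)..z, h s ^ 2) - I ^ 2) / z := by
    simp only [smul_eq_mul]
    field_simp
    ring
  rw [e2] at h0
  have h1 := mul_nonneg h0 hz.le
  rw [div_mul_cancel₀ _ hz.ne'] at h1
  linarith

section OneVariable

variable {t lam : ℝ} {F F' : ℝ → ℝ}

lemma thw_sq_le (ht : 0 ≤ t) (hl : lam < 1) (z : ℝ) : thw t lam z ^ 2 ≤ thw t 1 z ^ 2 := by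
  have hT := angT_ge_one ht
  rw [thw_sq, thw_sq]
  have : lam * z ^ 2 ≤ 1 * z ^ 2 := mul_le_mul_of_nonneg_right hl.le (sq_nonneg z)
  gcongr

/-- one-dimensional weighted Sobolev (Agmon) inequality, uniform in `t` -/
lemma sq_thw_mul_le (ht : 0 ≤ t) (hl0 : 0 ≤ lam) (hl : lam < 1)
    (hF : ∀ z, HasDerivAt F (F' z) z) (hF' : Continuous F')
    (hi : IntegrableOn (fun z => (thw t 1 z * F z) ^ 2) (Ioi 0))
    (hi' : IntegrableOn (fun z => (thw t 1 z * F' z) ^ 2) (Ioi 0)) {z : ℝ} (hz : 0 < z) :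
    (thw t lam z * F z) ^ 2 ≤ (2 + 4 / (1 - lam)) *
      ((∫ z in Ioi (0 : ℝ), (thw t 1 z * F z) ^ 2)
        + ∫ z in Ioi (0 : ℝ), (thw t 1 z * F' z) ^ 2) := by
  have hT := angT_ge_one ht
  have hT0 : 0 < angT t := by linarith
  have hμ : 0 < 1 - lam := by linarith
  have hFc : Continuous F := continuous_iff_continuousAt.2 fun z => (hF z).continuousAt
  have hθ := continuous_thw t lam
  have hd : ∀ s, HasDerivAt (fun s => (thw t lam s * F s) ^ 2)
      (lam * s / (2 * angT t) * (thw t lam s * F s) ^ 2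
        + 2 * (thw t lam s ^ 2 * (F s * F' s))) s := fun s => by
    refine HasDerivAt.congr_deriv (f := fun s => (thw t lam s * F s) ^ 2)
      (((hasDerivAt_thw t lam s).mul (hF s)).pow 2) ?_
    simp only [Pi.mul_apply]
    field_simp
    ring
  have hK : 0 ≤ 4 / (1 - lam) := by positivity
  have hbound : ∀ s ∈ Ioi (0 : ℝ), ‖lam * s / (2 * angT t) * (thw t lam s * F s) ^ 2
        + 2 * (thw t lam s ^ 2 * (F s * F' s))‖
      ≤ (2 + 4 / (1 - lam)) * ((thw t 1 s * F s) ^ 2 + (thw t 1 s * F' s) ^ 2) := by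
    intro s hs
    have hs : 0 < s := hs
    have hw := thw_sq_le ht hl s
    have hw0 : 0 ≤ thw t lam s ^ 2 := sq_nonneg _
    have hw1 : lam * s / (2 * angT t) * thw t lam s ^ 2 ≤ (1 + 4 / (1 - lam)) * thw t 1 s ^ 2 := by
      have h1 : lam * s / (2 * angT t) ≤ s / angT t := by
        rw [div_le_div_iff₀ (by positivity) hT0]
        nlinarith [mul_pos hs hT0]
      calc lam * s / (2 * angT t) * thw t lam s ^ 2 ≤ s / angT t * thw t lam s ^ 2 := by gcongr
        _ = s / angT t * Real.exp (-((1 - lam) * s ^ 2 / (4 * angT t))) * thw t 1 s ^ 2 := by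
          rw [thw_sq_eq_mul]; ring
        _ ≤ _ := mul_le_mul_of_nonneg_right (div_mul_exp_neg_le hμ hT s) (sq_nonneg _)
    have hc0 : 0 ≤ lam * s / (2 * angT t) := by positivity
    simp only [mul_pow]
    generalize thw t lam s ^ 2 = w at *
    generalize thw t 1 s ^ 2 = w1 at *
    have hw10 : 0 ≤ w1 := hw0.trans hw
    have h2 : |2 * (w * (F s * F' s))| ≤ w1 * (F s ^ 2 + F' s ^ 2) := by
      have h3 : |2 * (F s * F' s)| ≤ F s ^ 2 + F' s ^ 2 := by
        rw [abs_le]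
        constructor <;> nlinarith [sq_nonneg (F s - F' s), sq_nonneg (F s + F' s)]
      calc |2 * (w * (F s * F' s))| = w * |2 * (F s * F' s)| := by
            rw [← abs_of_nonneg hw0, ← abs_mul, abs_of_nonneg hw0]; ring_nf
        _ ≤ w1 * (F s ^ 2 + F' s ^ 2) := by gcongr
    calc ‖lam * s / (2 * angT t) * (w * F s ^ 2) + 2 * (w * (F s * F' s))‖
        ≤ |lam * s / (2 * angT t) * (w * F s ^ 2)| + |2 * (w * (F s * F' s))| := norm_add_le _ _
      _ ≤ (1 + 4 / (1 - lam)) * w1 * F s ^ 2 + w1 * (F s ^ 2 + F' s ^ 2) := by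
        refine add_le_add ?_ h2
        rw [abs_of_nonneg (by positivity), ← mul_assoc]
        exact mul_le_mul_of_nonneg_right hw1 (sq_nonneg _)
      _ ≤ _ := by
        have : 0 ≤ (1 + 4 / (1 - lam)) * (w1 * F' s ^ 2) := by positivity
        linarith
  have hsum : IntegrableOn (fun s => (2 + 4 / (1 - lam)) *
      ((thw t 1 s * F s) ^ 2 + (thw t 1 s * F' s) ^ 2)) (Ioi 0) := (hi.add hi').const_mul _
  have hint : IntegrableOn (fun s => lam * s / (2 * angT t) * (thw t lam s * F s) ^ 2
      + 2 * (thw t lam s ^ 2 * (F s * F' s))) (Ioi 0) :=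
    hsum.mono' (Continuous.aestronglyMeasurable (by fun_prop))
      (ae_restrict_of_forall_mem measurableSet_Ioi hbound)
  have hint0 : IntegrableOn (fun s => (thw t lam s * F s) ^ 2) (Ioi 0) := by
    refine hi.mono' (Continuous.aestronglyMeasurable (by fun_prop)) (.of_forall fun s => ?_)
    rw [Real.norm_of_nonneg (sq_nonneg _), mul_pow, mul_pow]
    exact mul_le_mul_of_nonneg_right (thw_sq_le ht hl s) (sq_nonneg _)
  have hlim := tendsto_zero_of_hasDerivAt_of_integrableOn_Ioi (fun s _ => hd s) hint hint0
  have hsub : Ioi z ⊆ Ioi (0 : ℝ) := Ioi_subset_Ioi hz.le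
  have hFTC := integral_Ioi_of_hasDerivAt_of_tendsto' (a := z) (fun s _ => hd s)
    (hint.mono_set hsub) hlim
  have hle := norm_integral_le_of_norm_le (hsum.mono_set hsub)
    (ae_restrict_of_forall_mem measurableSet_Ioi fun s hs => hbound s (hsub hs))
  rw [hFTC, zero_sub, norm_neg, Real.norm_of_nonneg (sq_nonneg _)] at hle
  refine hle.trans ((setIntegral_mono_set hsum (.of_forall fun s => ?_)
    hsub.eventuallyLE).trans_eq ?_)
  · simp only [Pi.zero_apply]
    positivity
  · rw [integral_const_mul, integral_add hi hi']

lemma sq_thw_mul_primitive_le (ht : 0 ≤ t) (hl : lam < 1) (hF : Continuous F)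
    (hi : IntegrableOn (fun z => (thw t 1 z * F z) ^ 2) (Ioi 0)) {z : ℝ} (hz : 0 < z) :
    (thw t lam z * (z / (2 * angT t) * (Real.exp (-(z ^ 2) / (4 * angT t)) *
        ∫ s in (0 : ℝ)..z, F s * Real.exp (s ^ 2 / (4 * angT t))))) ^ 2
      ≤ (4 / (1 - lam) + 32 / (1 - lam) ^ 2) * ∫ z in Ioi (0 : ℝ), (thw t 1 z * F z) ^ 2 := by
  have hT := angT_ge_one ht
  have hT0 : 0 < angT t := by linarith
  have hμ : 0 < 1 - lam := by linarith
  have hθ := continuous_thw t 1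
  set A := ∫ z in Ioi (0 : ℝ), (thw t 1 z * F z) ^ 2 with hA
  have hA0 : 0 ≤ A := integral_nonneg fun _ => sq_nonneg _
  set I := ∫ s in (0 : ℝ)..z, F s * Real.exp (s ^ 2 / (4 * angT t)) with hI
  have hI2 : I ^ 2 ≤ z * (Real.exp (z ^ 2 / (4 * angT t)) * A) := by
    refine (sq_intervalIntegral_le (by fun_prop) hz).trans
      (mul_le_mul_of_nonneg_left ?_ hz.le)
    calc ∫ s in (0 : ℝ)..z, (F s * Real.exp (s ^ 2 / (4 * angT t))) ^ 2
        ≤ ∫ s in (0 : ℝ)..z, Real.exp (z ^ 2 / (4 * angT t)) * (thw t 1 s * F s) ^ 2 := by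
          refine intervalIntegral.integral_mono_on hz.le
            ((by fun_prop : Continuous _).intervalIntegrable _ _)
            ((by fun_prop : Continuous _).intervalIntegrable _ _) fun s hs => ?_
          rw [mul_pow, mul_pow, thw_sq, one_mul]
          have h1 : Real.exp (s ^ 2 / (4 * angT t)) ≤ Real.exp (z ^ 2 / (4 * angT t)) := by
            have := hs.1
            have := hs.2
            gcongr
          nlinarith [mul_le_mul_of_nonneg_left h1
            (by positivity : 0 ≤ F s ^ 2 * Real.exp (s ^ 2 / (4 * angT t)))]
      _ = Real.exp (z ^ 2 / (4 * angT t)) * ∫ s in Ioc 0 z, (thw t 1 s * F s) ^ 2 := by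
          rw [intervalIntegral.integral_const_mul, intervalIntegral.integral_of_le hz.le]
      _ ≤ _ := by
          refine mul_le_mul_of_nonneg_left (setIntegral_mono_set hi
            (.of_forall fun s => sq_nonneg _) Ioc_subset_Ioi_self.eventuallyLE)
            (Real.exp_pos _).le
  have hexp : thw t lam z ^ 2 * Real.exp (-(z ^ 2) / (4 * angT t)) ^ 2
      * Real.exp (z ^ 2 / (4 * angT t)) = Real.exp (-((1 - lam) * z ^ 2 / (4 * angT t))) := by
    rw [thw_sq, ← Real.exp_nat_mul, ← Real.exp_add, ← Real.exp_add]
    congr 1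
    push_cast
    ring
  calc (thw t lam z * (z / (2 * angT t) * (Real.exp (-(z ^ 2) / (4 * angT t)) * I))) ^ 2
      = thw t lam z ^ 2 * Real.exp (-(z ^ 2) / (4 * angT t)) ^ 2 * (z / (2 * angT t)) ^ 2
          * I ^ 2 := by ring
    _ ≤ thw t lam z ^ 2 * Real.exp (-(z ^ 2) / (4 * angT t)) ^ 2 * (z / (2 * angT t)) ^ 2
          * (z * (Real.exp (z ^ 2 / (4 * angT t)) * A)) := by gcongr
    _ = z ^ 3 / angT t ^ 2 * Real.exp (-((1 - lam) * z ^ 2 / (4 * angT t))) * A / 4 := by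
        rw [← hexp]; field_simp; ring
    _ ≤ z ^ 3 / angT t ^ 2 * Real.exp (-((1 - lam) * z ^ 2 / (4 * angT t))) * A :=
        div_le_self (by positivity) (by norm_num)
    _ ≤ _ := mul_le_mul_of_nonneg_right (cube_div_mul_exp_neg_le hμ hT z) hA0

end OneVariable

lemma restrict_halfSpace :
    (volume : Measure (ℝ × ℝ × ℝ)).restrict {p | 0 < p.2.2}
      = (volume : Measure ℝ).prod ((volume : Measure ℝ).prod (volume.restrict (Ioi 0))) := by
  have h : {p : ℝ × ℝ × ℝ | 0 < p.2.2} = univ ×ˢ (univ ×ˢ Ioi 0) := by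
    ext p; simp
  rw [h, Measure.volume_eq_prod, ← Measure.prod_restrict, Measure.volume_eq_prod,
    ← Measure.prod_restrict, Measure.restrict_univ]

/-- A fibrewise bound by integrals in the last variable integrates to a bound of iterated
integrals; no measurability of the left-hand side is needed. -/
lemma integral_integral_le_of_fibre {ν : Measure ℝ} [SFinite ν] {P Q : ℝ × ℝ × ℝ → ℝ}
    (hP : Integrable P ((volume : Measure ℝ).prod ((volume : Measure ℝ).prod ν)))
    (hQ : Integrable Q ((volume : Measure ℝ).prod ((volume : Measure ℝ).prod ν)))
    {S : ℝ → ℝ → ℝ} (hS : ∀ x y, 0 ≤ S x y) {C : ℝ}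
    (h : ∀ x y, Integrable (fun z => P (x, y, z)) ν → Integrable (fun z => Q (x, y, z)) ν →
      S x y ≤ C * ((∫ z, P (x, y, z) ∂ν) + ∫ z, Q (x, y, z) ∂ν)) :
    ∫ x, ∫ y, S x y ≤
      C * ((∫ x, ∫ y, ∫ z, P (x, y, z) ∂ν) + ∫ x, ∫ y, ∫ z, Q (x, y, z) ∂ν) := by
  have outer : ∀ {R : ℝ × ℝ × ℝ → ℝ},
      Integrable R ((volume : Measure ℝ).prod ((volume : Measure ℝ).prod ν)) →
      Integrable fun x => ∫ y, ∫ z, R (x, y, z) ∂ν := fun {R} hR => by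
    refine hR.integral_prod_left.congr ?_
    filter_upwards [hR.prod_right_ae] with x hx
    exact integral_prod _ hx
  rw [← integral_add (outer hP) (outer hQ), ← integral_const_mul]
  refine integral_mono_of_nonneg (.of_forall fun x => integral_nonneg (hS x))
    (((outer hP).add (outer hQ)).const_mul C) ?_
  filter_upwards [hP.prod_right_ae, hQ.prod_right_ae] with x hPx hQx
  rw [← integral_add hPx.integral_prod_left hQx.integral_prod_left, ← integral_const_mul]
  refine integral_mono_of_nonneg (.of_forall (hS x))
    ((hPx.integral_prod_left.add hQx.integral_prod_left).const_mul C) ?_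
  filter_upwards [hPx.prod_right_ae, hQx.prod_right_ae] with y hPy hQy
  exact h x y hPy hQy

lemma Smooth3.sq_iSup_urOp_le {t lam : ℝ} (ht : 0 ≤ t) (hl0 : 0 ≤ lam) (hl : lam < 1)
    {f : ℝ → ℝ → ℝ → ℝ} (hf : Smooth3 f) (n : ℕ) (x y : ℝ)
    (hi : IntegrableOn (fun z => (thw t 1 z * angR x y ^ n * f x y z) ^ 2) (Ioi 0))
    (hi' : IntegrableOn (fun z => (thw t 1 z * angR x y ^ n * pdz f x y z) ^ 2) (Ioi 0)) :
    (⨆ z : Ioi (0 : ℝ), |thw t lam (z : ℝ) * angR x y ^ n * urOp t f x y (z : ℝ)|) ^ 2 ≤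
      (2 * (2 + 4 / (1 - lam)) + 2 * (4 / (1 - lam) + 32 / (1 - lam) ^ 2)) *
        ((∫ z in Ioi (0 : ℝ), (thw t 1 z * angR x y ^ n * f x y z) ^ 2)
          + ∫ z in Ioi (0 : ℝ), (thw t 1 z * angR x y ^ n * pdz f x y z) ^ 2) := by
  have hμ : 0 < 1 - lam := by linarith
  have hm : Continuous fun z : ℝ => ((x, y, z) : ℝ × ℝ × ℝ) := by fun_prop
  set r := angR x y ^ n
  simp only [mul_assoc (thw t _ _)] at hi hi' ⊢
  set A := ∫ z in Ioi (0 : ℝ), (thw t 1 z * (r * f x y z)) ^ 2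
  set B := ∫ z in Ioi (0 : ℝ), (thw t 1 z * (r * pdz f x y z)) ^ 2
  have hA : 0 ≤ A := integral_nonneg fun _ => sq_nonneg _
  have hB : 0 ≤ B := integral_nonneg fun _ => sq_nonneg _
  have hL : 0 ≤ 4 / (1 - lam) + 32 / (1 - lam) ^ 2 := by positivity
  have hpt : ∀ z : Ioi (0 : ℝ), (thw t lam (z : ℝ) * (r * urOp t f x y z)) ^ 2 ≤
      (2 * (2 + 4 / (1 - lam)) + 2 * (4 / (1 - lam) + 32 / (1 - lam) ^ 2)) * (A + B) := by
    rintro ⟨z, hz⟩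
    have h1 := sq_thw_mul_le (F := fun z => r * f x y z) (F' := fun z => r * pdz f x y z)
      ht hl0 hl (fun z => (hf.hasDerivAt_z x y z).const_mul r)
      (continuous_const.mul (hf.smooth_pdz.continuous.comp hm)) hi hi' hz
    have h2 := sq_thw_mul_primitive_le (F := fun z => r * f x y z) ht hl
      (continuous_const.mul (hf.continuous.comp hm)) hi hz
    simp only [mul_assoc r, intervalIntegral.integral_const_mul] at h2
    have e : thw t lam z * (r * urOp t f x y z) = thw t lam z * (r * f x y z)
        - thw t lam z * (z / (2 * angT t) * (Real.exp (-(z ^ 2) / (4 * angT t)) *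
          (r * ∫ s in (0 : ℝ)..z, f x y s * Real.exp (s ^ 2 / (4 * angT t))))) := by
      simp only [urOp, phiF]
      ring
    rw [e]
    have h3 : ∀ p q : ℝ, (p - q) ^ 2 ≤ 2 * p ^ 2 + 2 * q ^ 2 := fun p q => by
      linarith [sq_nonneg (p + q), (by ring : (p - q) ^ 2 + (p + q) ^ 2 = 2 * p ^ 2 + 2 * q ^ 2)]
    refine (h3 _ _).trans ?_
    linarith [mul_nonneg hL hB]
  have hC : 0 ≤ (2 * (2 + 4 / (1 - lam)) + 2 * (4 / (1 - lam) + 32 / (1 - lam) ^ 2)) * (A + B) := by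
    positivity
  refine (pow_le_pow_left₀ (Real.iSup_nonneg fun _ => abs_nonneg _)
    (Real.iSup_le (fun z => Real.abs_le_sqrt (hpt z)) (Real.sqrt_nonneg _)) 2).trans_eq
    (Real.sq_sqrt hC)

lemma sqrt_add_le_add_sqrt {a b : ℝ} (ha : 0 ≤ a) (hb : 0 ≤ b) : √(a + b) ≤ √a + √b := by
  refine Real.sqrt_le_iff.2 ⟨by positivity, ?_⟩
  linarith [add_sq √a √b, Real.sq_sqrt ha, Real.sq_sqrt hb,
    mul_nonneg (Real.sqrt_nonneg a) (Real.sqrt_nonneg b)]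

/-- `L²_h L^∞_z` bound for `u^r`. -/
theorem L2hLinfz_bound_ur :
    ∀ lam : ℝ, 0 ≤ lam → lam < 1 → ∃ C : ℝ, 0 < C ∧
      ∀ t : ℝ, 0 ≤ t → ∀ g : ℝ → ℝ → ℝ → ℝ, DecaySmooth g → L2cond t g → L2condZ t g →
        ∀ n a b : ℕ, a + b = n →
          L2hIz t lam n (pdh a b (ur t g)) ≤
            C * (L2w t 1 n (pdh a b g) + L2w t 1 n (pdh a b (pdz g))) := by
  intro lam hl0 hl
  have hμ : 0 < 1 - lam := by linarith
  set K := 2 * (2 + 4 / (1 - lam)) + 2 * (4 / (1 - lam) + 32 / (1 - lam) ^ 2) with hK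
  have hK0 : 0 < K := by positivity
  refine ⟨√K, Real.sqrt_pos.2 hK0, fun t ht g hg hg1 hg2 n a b hab => ?_⟩
  subst hab
  have hs : Smooth3 g := hg.1
  obtain ⟨hf, hur⟩ := pdh_comm (A := urOp t) (fun _ h => pdx_urOp h) (fun _ h => pdy_urOp h) a b hs
  have hz := (pdh_comm (A := pdz) (fun _ h => h.pdx_pdz) (fun _ h => h.pdy_pdz) a b hs).2
  have h1 := hg1 a b
  have h2 := hg2 a b
  rw [hs.ur_eq, hur, hz]
  rw [hz] at h2
  rw [restrict_halfSpace] at h1 h2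
  have key := integral_integral_le_of_fibre h1 h2
    (S := fun x y => (⨆ z : Ioi (0 : ℝ),
      |thw t lam (z : ℝ) * angR x y ^ (a + b) * urOp t (pdh a b g) x y (z : ℝ)|) ^ 2)
    (fun _ _ => sq_nonneg _)
    (fun x y hi hi' => hf.sq_iSup_urOp_le ht hl0 hl (a + b) x y hi hi')
  unfold L2hIz L2w
  refine (Real.sqrt_le_sqrt key).trans ?_
  rw [Real.sqrt_mul hK0.le]
  exact mul_le_mul_of_nonneg_left (sqrt_add_le_add_sqrt
    (integral_nonneg fun _ => integral_nonneg fun _ => integral_nonneg fun _ => sq_nonneg _)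
    (integral_nonneg fun _ => integral_nonneg fun _ => integral_nonneg fun _ => sq_nonneg _))
    (Real.sqrt_nonneg _)
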